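/- For every ε ∈ (0, 0.1), setting P = (0.4, 0.5, 0.5−ε), every r ∈ Δ_3 attaining sup_{r' ∈ Δ_3} G(r'; P) satisfies r_2·d(0.5, 0.5−ε) ≥ ε²/6 and r_3·d(0.5−ε, 0.5) ≥ ε²/6. -/

import Mathlib

open MeasureTheory Filter Set
open scoped ENNReal NNReal

noncomputable section

/-- KL divergence between Bernoulli distributions with means `q` and `p`
(conventions: `0·log(0/x) = 0`, and the divergence is `∞` if `p ∈ {0,1}` and `q ≠ p`). -/
def klBer (q p : ℝ) : ℝ≥0∞ :=
  if (p = 0 ∧ q ≠ 0) ∨ (p = 1 ∧ q ≠ 1) then ⊤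
  else ENNReal.ofReal (q * Real.log (q / p) + (1 - q) * Real.log ((1 - q) / (1 - p)))

/-- The probability simplex `Δ_K`. -/
def probSimplex (K : ℕ) : Set (Fin K → ℝ) := {r | (∀ i, 0 ≤ r i) ∧ ∑ i, r i = 1}

/-- The set of best arms `I*(P) = {i : P i = max_j P j}`. -/
def bestArms {K : ℕ} (P : Fin K → ℝ) : Set (Fin K) := {i | ∀ j, P j ≤ P i}

/-- The set of alternative instances `Alt(P)`: instances `P' ∈ [0,1]³` having a best arm
that is not a best arm of `P`. -/
def altSet (P : Fin 3 → ℝ) : Set (Fin 3 → ℝ) :=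
  {P' | (∀ i, P' i ∈ Icc (0 : ℝ) 1) ∧ ¬ bestArms P' ⊆ bestArms P}

/-- `G(r; P) = inf_{P' ∈ Alt(P)} Σ_i r_i·d(P_i, P'_i)`. -/
def Gfun (r P : Fin 3 → ℝ) : ℝ≥0∞ :=
  ⨅ (P' : Fin 3 → ℝ) (_ : P' ∈ altSet P), ∑ i, ENNReal.ofReal (r i) * klBer (P i) (P' i)

theorem hellinger_bound {a b c d : ℝ} (ha : 0 ≤ a) (hb : 0 ≤ b) (hc : 0 ≤ c) (hd : 0 ≤ d)
    (hac : a ^ 2 + c ^ 2 = 1) (hbd : b ^ 2 + d ^ 2 = 1) :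
    (a ^ 2 - b ^ 2) ^ 2 ≤ 2 - 2 * (a * b + c * d) := by
  have hs : 0 ≤ a * b + c * d := by positivity
  have h1 : (a * d - b * c) ^ 2 + (a * b + c * d) ^ 2 = 1 := by
    linear_combination (b ^ 2 + d ^ 2) * hac + hbd
  have h2 : (a * d + b * c) ^ 2 + (a * b - c * d) ^ 2 = 1 := by
    linear_combination (b ^ 2 + d ^ 2) * hac + hbd
  have h3 : a ^ 2 - b ^ 2 = (a * d - b * c) * (a * d + b * c) := by
    linear_combination b ^ 2 * hac - a ^ 2 * hbd
  have h4 : (a * d + b * c) ^ 2 ≤ 1 := by nlinarith [sq_nonneg (a * b - c * d)]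
  rw [h3, mul_pow]
  nlinarith [mul_le_mul_of_nonneg_left h4 (sq_nonneg (a * d - b * c)),
    sq_nonneg (a * b + c * d - 1)]

theorem mul_log_div_ge {q p : ℝ} (hq : 0 < q) (hp : 0 < p) :
    2 * (q - √q * √p) ≤ q * Real.log (q / p) := by
  have hsq := Real.sqrt_pos.2 hq
  have hsp := Real.sqrt_pos.2 hp
  have h1 : Real.log (√p / √q) ≤ √p / √q - 1 := Real.log_le_sub_one_of_pos (by positivity)
  have h2 : Real.log (q / p) = -2 * Real.log (√p / √q) := by
    rw [Real.log_div hq.ne' hp.ne', Real.log_div hsp.ne' hsq.ne', Real.log_sqrt hp.le,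
      Real.log_sqrt hq.le]
    ring
  have h3 : q * (√p / √q) = √q * √p := by
    nth_rewrite 1 [← Real.mul_self_sqrt hq.le]
    field_simp
  rw [h2]
  nlinarith [mul_le_mul_of_nonneg_left h1 hq.le]

/-- A weak form of Pinsker's inequality for Bernoulli distributions. -/
theorem ofReal_sq_sub_le_klBer {q p : ℝ} (hq : q ∈ Ioo (0 : ℝ) 1) (hp : p ∈ Icc (0 : ℝ) 1) :
    ENNReal.ofReal ((q - p) ^ 2) ≤ klBer q p := by
  obtain ⟨hq0, hq1⟩ := hq
  unfold klBer
  split_ifs with h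
  · exact le_top
  push Not at h
  have hp0 : 0 < p := lt_of_le_of_ne hp.1 fun e => hq0.ne' (h.1 e.symm)
  have hp1 : p < 1 := lt_of_le_of_ne hp.2 fun e => hq1.ne (h.2 e)
  have hq' : 0 < 1 - q := by linarith
  have hp' : 0 < 1 - p := by linarith
  apply ENNReal.ofReal_le_ofReal
  have h1 := mul_log_div_ge hq0 hp0
  have h2 := mul_log_div_ge hq' hp'
  have h3 := hellinger_bound (Real.sqrt_nonneg q) (Real.sqrt_nonneg p) (Real.sqrt_nonneg (1 - q))
    (Real.sqrt_nonneg (1 - p))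
    (by rw [Real.sq_sqrt hq0.le, Real.sq_sqrt hq'.le]; ring)
    (by rw [Real.sq_sqrt hp0.le, Real.sq_sqrt hp'.le]; ring)
  rw [Real.sq_sqrt hq0.le, Real.sq_sqrt hp0.le] at h3
  linarith

theorem klBer_self {q : ℝ} (hq : q ∈ Ioo (0 : ℝ) 1) : klBer q q = 0 := by
  have h0 : q ≠ 0 := hq.1.ne'
  have h1 : 1 - q ≠ 0 := by linarith [hq.2]
  simp [klBer, div_self h0, div_self h1]

theorem Gfun_le {r P P' : Fin 3 → ℝ} (h : P' ∈ altSet P) :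
    Gfun r P ≤ ∑ i, ENNReal.ofReal (r i) * klBer (P i) (P' i) :=
  iInf₂_le P' h

theorem Gfun_uniform_ge {ε : ℝ} {P : Fin 3 → ℝ} (hP : ∀ i, P i ∈ Ioo (0 : ℝ) 1) {k : Fin 3}
    (hε : 0 ≤ ε) (hgap : ∀ j, j ≠ k → P j + ε ≤ P k) :
    ENNReal.ofReal (ε ^ 2 / 6) ≤ Gfun (fun _ => 1 / 3) P := by
  refine le_iInf₂ fun P' ⟨hP', hbest⟩ => ?_
  obtain ⟨j, hj, hjP⟩ := Set.not_subset.1 hbest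
  have hjk : j ≠ k := by
    rintro rfl
    refine hjP fun i => ?_
    rcases eq_or_ne i j with rfl | hi
    · exact le_rfl
    · linarith [hgap i hi]
  have hsum : (P k - P' k) ^ 2 + (P j - P' j) ^ 2 ≤ ∑ i, (P i - P' i) ^ 2 := by
    rw [← Finset.sum_pair hjk.symm (f := fun i => (P i - P' i) ^ 2)]
    exact Finset.sum_le_sum_of_subset_of_nonneg (Finset.subset_univ _)
      fun _ _ _ => sq_nonneg _
  calc ENNReal.ofReal (ε ^ 2 / 6)
      ≤ ENNReal.ofReal (∑ i, 1 / 3 * (P i - P' i) ^ 2) := by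
        apply ENNReal.ofReal_le_ofReal
        rw [← Finset.mul_sum]
        have h := hj k
        have hg := hgap j hjk
        nlinarith [sq_nonneg (P k - P' k + (P j - P' j)),
          mul_self_le_mul_self hε (show ε ≤ P k - P' k - (P j - P' j) by linarith)]
    _ = ∑ i, ENNReal.ofReal (1 / 3) * ENNReal.ofReal ((P i - P' i) ^ 2) := by
        rw [ENNReal.ofReal_sum_of_nonneg fun _ _ => by positivity]
        exact Finset.sum_congr rfl fun _ _ => ENNReal.ofReal_mul (by norm_num)
    _ ≤ _ := by
        gcongr with i
        exact ofReal_sq_sub_le_klBer (hP i) (hP' i)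

/-- Lemma 2: for the instance `P = (0.4, 0.5, 0.5−ε)` with `ε ∈ (0, 0.1)`, every
allocation `r ∈ Δ₃` attaining `sup_{r'} G(r'; P)` satisfies
`r_2·d(0.5, 0.5−ε) ≥ ε²/6` and `r_3·d(0.5−ε, 0.5) ≥ ε²/6`. -/
theorem fc_optimal_alloc_two (ε : ℝ) (hε : ε ∈ Ioo (0 : ℝ) 0.1)
    (r : Fin 3 → ℝ) (hr : r ∈ probSimplex 3)
    (hmax : ∀ r' ∈ probSimplex 3,
      Gfun r' ![0.4, 0.5, 0.5 - ε] ≤ Gfun r ![0.4, 0.5, 0.5 - ε]) :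
    ENNReal.ofReal (ε ^ 2 / 6) ≤ ENNReal.ofReal (r 1) * klBer 0.5 (0.5 - ε) ∧
      ENNReal.ofReal (ε ^ 2 / 6) ≤ ENNReal.ofReal (r 2) * klBer (0.5 - ε) 0.5 := by
  obtain ⟨h0, h1⟩ := hε
  have hP : ∀ i, (![0.4, 0.5, 0.5 - ε] : Fin 3 → ℝ) i ∈ Ioo (0 : ℝ) 1 := by
    intro i
    fin_cases i <;> constructor <;> norm_num at h1 ⊢ <;> linarith
  have hnot : (2 : Fin 3) ∉ bestArms ![0.4, 0.5, 0.5 - ε] := by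
    intro h
    have h : (0.5 : ℝ) ≤ 0.5 - ε := h 1
    linarith
  have hG : ENNReal.ofReal (ε ^ 2 / 6) ≤ Gfun r ![0.4, 0.5, 0.5 - ε] := by
    refine (Gfun_uniform_ge hP (k := 1) h0.le ?_).trans (hmax _ ⟨fun _ => by norm_num, by simp⟩)
    intro j hj
    fin_cases j
    · norm_num at h1 ⊢
      linarith
    · exact absurd rfl hj
    · change 0.5 - ε + ε ≤ 0.5
      linarith
  constructor
  · have hmem : ![0.4, 0.5 - ε, 0.5 - ε] ∈ altSet ![0.4, 0.5, 0.5 - ε] := by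
      refine ⟨fun i => ?_, fun h => hnot (h fun j => ?_)⟩
      · fin_cases i <;> constructor <;> norm_num at h1 ⊢ <;> linarith
      · change _ ≤ 0.5 - ε
        fin_cases j <;> norm_num at h1 ⊢ <;> linarith
    have h := hG.trans (Gfun_le hmem)
    have e0 := klBer_self (hP 0)
    have e2 := klBer_self (hP 2)
    simp only [Fin.sum_univ_three, Matrix.cons_val] at h e0 e2
    simpa only [e0, e2, mul_zero, zero_add, add_zero] using h
  · have hmem : ![0.4, 0.5, 0.5] ∈ altSet ![0.4, 0.5, 0.5 - ε] := by
      refine ⟨fun i => ?_, fun h => hnot (h fun j => ?_)⟩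
      · fin_cases i <;> constructor <;> norm_num
      · change _ ≤ (0.5 : ℝ)
        fin_cases j <;> norm_num
    have h := hG.trans (Gfun_le hmem)
    have e0 := klBer_self (hP 0)
    have e1 := klBer_self (hP 1)
    simp only [Fin.sum_univ_three, Matrix.cons_val] at h e0 e1
    simpa only [e0, e1, mul_zero, zero_add, add_zero] using h

end
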